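/- The spectrum of the vertical Laplacian Δ^V = −X₁X₁ = (1/2)h² of the Hopf map, restricted to the eigenspace of the Laplacian of S³(√2) with eigenvalue λ_k = k(k+2)/2, consists of the values (k−2l)²/2 for l ∈ {0,…,k}; each nonzero value (k−2l)²/2 with k−2l ≠ 0 has multiplicity 2(k+1), and when k is even the value 0 has multiplicity k+1. -/

import Mathlib

open MvPolynomial

/-- The polynomial ring ℂ[z, z̄, w, w̄]: variables 0 = z, 1 = z̄, 2 = w, 3 = w̄. -/
abbrev Rpoly := MvPolynomial (Fin 4) ℂ

/-- Multiplication by the variable `i` as a linear operator. -/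
noncomputable def mulX (i : Fin 4) : Module.End ℂ Rpoly :=
  LinearMap.mulLeft ℂ (X i)

/-- The partial derivative `∂ᵢ` as a linear operator. -/
noncomputable def pd (i : Fin 4) : Module.End ℂ Rpoly :=
  (pderiv i).toLinearMap

/-- `e = i(w̄ ∂_z − z̄ ∂_w)`. -/
noncomputable def eOp : Module.End ℂ Rpoly :=
  Complex.I • (mulX 3 * pd 0 - mulX 1 * pd 2)

/-- `f = i(w ∂_z̄ − z ∂_w̄)`. -/
noncomputable def fOp : Module.End ℂ Rpoly :=
  Complex.I • (mulX 2 * pd 1 - mulX 0 * pd 3)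

/-- `h = z̄ ∂_z̄ − z ∂_z + w̄ ∂_w̄ − w ∂_w`. -/
noncomputable def hOp : Module.End ℂ Rpoly :=
  mulX 1 * pd 1 - mulX 0 * pd 0 + mulX 3 * pd 3 - mulX 2 * pd 2

/-- `Δ = −4(∂_z ∂_z̄ + ∂_w ∂_w̄)`, the Laplacian on ℂ². -/
noncomputable def ΔOp : Module.End ℂ Rpoly :=
  (-4 : ℂ) • (pd 1 * pd 0 + pd 3 * pd 2)

/-- `H^k`: harmonic homogeneous polynomials of degree `k`; its restrictions to
`S³(√2)` are the eigenfunctions of the Laplacian with eigenvalue `λ_k = k(k+2)/2`. -/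
noncomputable def Hk (k : ℕ) : Submodule ℂ Rpoly :=
  homogeneousSubmodule (Fin 4) ℂ k ⊓ LinearMap.ker ΔOp

/-- The vertical Laplacian of the Hopf map, `Δ^V = −X₁X₁ = (1/2)h²`, realised on
harmonic polynomials via `X₁ = h/(i√2)`. -/
noncomputable def vertLap : Module.End ℂ Rpoly :=
  (1 / 2 : ℂ) • (hOp * hOp)

/-- The exponent with entries `i, j, u, v`. -/
noncomputable def mkE (i j u v : ℕ) : Fin 4 →₀ ℕ := Finsupp.equivFunOnFinite.symm ![i, j, u, v]

lemma mkE_zero (i j u v : ℕ) : mkE i j u v 0 = i := rfl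
lemma mkE_one (i j u v : ℕ) : mkE i j u v 1 = j := rfl
lemma mkE_two (i j u v : ℕ) : mkE i j u v 2 = u := rfl
lemma mkE_three (i j u v : ℕ) : mkE i j u v 3 = v := rfl

lemma exp_ext {m n : Fin 4 →₀ ℕ} (h0 : m 0 = n 0) (h1 : m 1 = n 1) (h2 : m 2 = n 2)
    (h3 : m 3 = n 3) : m = n := by
  ext i
  fin_cases i
  · exact h0
  · exact h1
  · exact h2
  · exact h3

lemma mkE_eta (m : Fin 4 →₀ ℕ) : mkE (m 0) (m 1) (m 2) (m 3) = m :=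
  exp_ext rfl rfl rfl rfl

/-- Exponents of bidegree `(a, b)`. -/
def bideg (a b : ℕ) : Set (Fin 4 →₀ ℕ) := {m | m 0 + m 2 = a ∧ m 1 + m 3 = b}

/-- Exponents of bidegree `(a, b)` as a product. -/
noncomputable def bidegEquiv (a b : ℕ) : bideg a b ≃ Fin (a + 1) × Fin (b + 1) where
  toFun m := (⟨m.1 0, by have := m.2.1; omega⟩, ⟨m.1 1, by have := m.2.2; omega⟩)
  invFun x := ⟨mkE x.1 x.2 (a - x.1) (b - x.2), by
    constructor
    · rw [mkE_zero, mkE_two]; omega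
    · rw [mkE_one, mkE_three]; omega⟩
  left_inv m := by
    have h1 := m.2.1
    have h2 := m.2.2
    apply Subtype.ext
    apply exp_ext
    · rfl
    · rfl
    · change a - m.1 0 = m.1 2; omega
    · change b - m.1 1 = m.1 3; omega
  right_inv x := by
    rfl

lemma coeff_X_mul_pd (i : Fin 4) (p : Rpoly) (m : Fin 4 →₀ ℕ) :
    coeff m ((mulX i * pd i) p) = (m i : ℂ) * coeff m p := by
  change coeff m (X i * pderiv i p) = _
  rw [coeff_X_mul']
  split_ifs with h
  · rw [coeff_pderiv]
    have hi : m i ≠ 0 := by simpa using h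
    have h1 : m - Finsupp.single i 1 + Finsupp.single i 1 = m := by
      apply tsub_add_cancel_of_le
      rw [Finsupp.single_le_iff]
      omega
    rw [h1]
    have h2 : (m - Finsupp.single i 1 : Fin 4 →₀ ℕ) i = m i - 1 := by simp
    rw [h2, Nat.cast_sub (by omega)]
    push_cast
    ring
  · have hi : m i = 0 := by simpa using h
    simp [hi]

lemma coeff_hOp (p : Rpoly) (m : Fin 4 →₀ ℕ) :
    coeff m (hOp p) = ((m 1 : ℂ) - m 0 + m 3 - m 2) * coeff m p := by
  simp only [hOp, LinearMap.sub_apply, LinearMap.add_apply, coeff_sub, coeff_add, coeff_X_mul_pd]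
  ring

lemma coeff_vertLap (p : Rpoly) (m : Fin 4 →₀ ℕ) :
    coeff m (vertLap p) = ((m 1 : ℂ) - m 0 + m 3 - m 2) ^ 2 / 2 * coeff m p := by
  simp only [vertLap, LinearMap.smul_apply, Module.End.mul_apply, coeff_smul, coeff_hOp, smul_eq_mul]
  ring

lemma coeff_ΔOp (p : Rpoly) (m : Fin 4 →₀ ℕ) :
    coeff m (ΔOp p) = (-4) * (((m 0 : ℂ) + 1) * (m 1 + 1) *
        coeff (mkE (m 0 + 1) (m 1 + 1) (m 2) (m 3)) p +
      ((m 2 : ℂ) + 1) * (m 3 + 1) * coeff (mkE (m 0) (m 1) (m 2 + 1) (m 3 + 1)) p) := by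
  have e1 : m + Finsupp.single 1 1 + Finsupp.single 0 1 =
      mkE (m 0 + 1) (m 1 + 1) (m 2) (m 3) := by
    apply exp_ext <;> simp [mkE_zero, mkE_one, mkE_two, mkE_three, Finsupp.single_apply]
  have e2 : m + Finsupp.single 3 1 + Finsupp.single 2 1 =
      mkE (m 0) (m 1) (m 2 + 1) (m 3 + 1) := by
    apply exp_ext <;> simp [mkE_zero, mkE_one, mkE_two, mkE_three, Finsupp.single_apply]
  simp only [ΔOp, LinearMap.smul_apply, Module.End.mul_apply, coeff_smul, LinearMap.add_apply,
    coeff_add, smul_eq_mul]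
  change -4 * (coeff m (pderiv 1 (pderiv 0 p)) + coeff m (pderiv 3 (pderiv 2 p))) = _
  simp only [coeff_pderiv, e1, e2]
  simp [Finsupp.single_apply]
  ring

/-- Harmonic polynomials of bidegree `(a, b)`. -/
noncomputable def Hab (a b : ℕ) : Submodule ℂ Rpoly :=
  restrictSupport ℂ (bideg a b) ⊓ LinearMap.ker ΔOp

lemma mem_rs {s : Set (Fin 4 →₀ ℕ)} {p : Rpoly} :
    p ∈ restrictSupport ℂ s ↔ ∀ m, m ∉ s → coeff m p = 0 := by
  rw [mem_restrictSupport_iff]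
  constructor
  · intro h m hm
    by_contra hc
    exact hm (h (by simpa using hc))
  · intro h m hm
    by_contra hc
    exact (by simpa using hm : coeff m p ≠ 0) (h m hc)

lemma harm_iff (p : Rpoly) : p ∈ LinearMap.ker ΔOp ↔ ∀ i j u v : ℕ,
    ((i : ℂ) + 1) * (j + 1) * coeff (mkE (i + 1) (j + 1) u v) p +
      ((u : ℂ) + 1) * (v + 1) * coeff (mkE i j (u + 1) (v + 1)) p = 0 := by
  rw [LinearMap.mem_ker]
  constructor
  · intro h i j u v
    have := coeff_ΔOp p (mkE i j u v)
    rw [h] at this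
    simp only [mkE_zero, mkE_one, mkE_two, mkE_three, coeff_zero] at this
    simpa using this.symm
  · intro h
    ext m
    rw [coeff_ΔOp, h]
    simp

/-- Boundary coefficients. -/
noncomputable def bdry (a b : ℕ) : Rpoly →ₗ[ℂ] (Fin (a + b + 1) → ℂ) :=
  LinearMap.pi fun t => lcoeff ℂ (mkE (t - b) (b - t) (a - (t - b)) (b - (b - t)))

lemma Hab_zero (a b : ℕ) (p : Rpoly) (hp : p ∈ Hab a b) (h : bdry a b p = 0) : p = 0 := by
  have hs := mem_rs.1 hp.1
  have hh := (harm_iff p).1 hp.2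
  have hb : ∀ t : ℕ, t < a + b + 1 →
      coeff (mkE (t - b) (b - t) (a - (t - b)) (b - (b - t))) p = 0 := by
    intro t ht
    exact congrFun h ⟨t, ht⟩
  have key : ∀ i j u v : ℕ, coeff (mkE i j u v) p = 0 := by
    intro i
    induction i with
    | zero =>
      intro j u v
      by_cases hm : mkE 0 j u v ∈ bideg a b
      · have h1 : 0 + u = a := hm.1
        have h2 : j + v = b := hm.2
        have := hb (b - j) (by omega)
        convert this using 3 <;> omega
      · exact hs _ hm
    | succ i ih =>
      intro j u v
      by_cases hm : mkE (i + 1) j u v ∈ bideg a b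
      · have h1 : i + 1 + u = a := hm.1
        have h2 : j + v = b := hm.2
        rcases j with _ | j
        · have := hb (b + i + 1) (by omega)
          convert this using 3 <;> omega
        · have := hh i j u v
          rw [ih, mul_zero, add_zero] at this
          have c1 : ((i : ℂ) + 1) ≠ 0 := by exact_mod_cast Nat.succ_ne_zero i
          have c2 : ((j : ℂ) + 1) ≠ 0 := by exact_mod_cast Nat.succ_ne_zero j
          exact (mul_eq_zero.1 this).resolve_left (mul_ne_zero c1 c2)
      · exact hs _ hm
  ext m
  rw [← mkE_eta m, key, coeff_zero]

instance bideg_finite (a b : ℕ) : Finite (bideg a b) := Finite.of_equiv _ (bidegEquiv a b).symm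

instance rs_fd (a b : ℕ) : FiniteDimensional ℂ (restrictSupport ℂ (bideg a b)) :=
  Module.Finite.of_basis (basisRestrictSupport ℂ (bideg a b))

instance Hab_fd (a b : ℕ) : FiniteDimensional ℂ (Hab a b) :=
  Submodule.finiteDimensional_of_le (inf_le_left : Hab a b ≤ restrictSupport ℂ (bideg a b))

lemma finrank_rs (a b : ℕ) :
    Module.finrank ℂ (restrictSupport ℂ (bideg a b)) = (a + 1) * (b + 1) := by
  rw [Module.finrank_eq_card_basis
    ((basisRestrictSupport ℂ (bideg a b)).reindex (bidegEquiv a b))]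
  simp

/-- Coefficients of the Laplacian. -/
noncomputable def lapc (a b : ℕ) : restrictSupport ℂ (bideg a b) →ₗ[ℂ] (Fin a × Fin b → ℂ) :=
  (LinearMap.pi fun t => lcoeff ℂ (mkE t.1 t.2 (a - 1 - t.1) (b - 1 - t.2))) ∘ₗ ΔOp ∘ₗ
    (restrictSupport ℂ (bideg a b)).subtype

lemma lapc_ker (a b : ℕ) (p : restrictSupport ℂ (bideg a b)) (h : lapc a b p = 0) :
    (p : Rpoly) ∈ Hab a b := by
  refine ⟨p.2, ?_⟩
  have hs := mem_rs.1 p.2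
  rw [SetLike.mem_coe, harm_iff]
  intro i j u v
  by_cases hm : mkE (i + 1) (j + 1) u v ∈ bideg a b
  · have h1 : i + 1 + u = a := hm.1
    have h2 : j + 1 + v = b := hm.2
    have h3 : coeff (mkE i j (a - 1 - i) (b - 1 - j)) (ΔOp p) = 0 :=
      congrFun h (⟨i, by omega⟩, ⟨j, by omega⟩)
    rw [show a - 1 - i = u by omega, show b - 1 - j = v by omega, coeff_ΔOp] at h3
    simp only [mkE_zero, mkE_one, mkE_two, mkE_three] at h3
    simpa using h3
  · have hm2 : mkE i j (u + 1) (v + 1) ∉ bideg a b := by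
      rintro ⟨h1, h2⟩
      apply hm
      simp only [mkE_zero, mkE_one, mkE_two, mkE_three] at h1 h2
      constructor
      · simp only [mkE_zero, mkE_two]; omega
      · simp only [mkE_one, mkE_three]; omega
    rw [hs _ hm, hs _ hm2]
    simp

lemma finrank_Hab (a b : ℕ) : Module.finrank ℂ (Hab a b) = a + b + 1 := by
  apply le_antisymm
  · have := LinearMap.finrank_le_finrank_of_injective (f := (bdry a b) ∘ₗ (Hab a b).subtype) (by
      rw [← LinearMap.ker_eq_bot, LinearMap.ker_eq_bot']
      intro p hp
      exact Subtype.ext (Hab_zero a b p p.2 hp))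
    simpa using this
  · have h1 := LinearMap.finrank_range_add_finrank_ker (lapc a b)
    have h2 : Module.finrank ℂ (LinearMap.range (lapc a b)) ≤ a * b := by
      have := Submodule.finrank_le (LinearMap.range (lapc a b))
      simpa using this
    have h3 : Module.finrank ℂ (LinearMap.ker (lapc a b)) ≤ Module.finrank ℂ (Hab a b) := by
      apply LinearMap.finrank_le_finrank_of_injective
        (f := (((restrictSupport ℂ (bideg a b)).subtype) ∘ₗ
          (LinearMap.ker (lapc a b)).subtype).codRestrict (Hab a b)
          (fun p => lapc_ker a b p.1 p.2))
      intro p q hpq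
      have := congrArg Subtype.val hpq
      exact Subtype.ext (Subtype.ext this)
    rw [finrank_rs] at h1
    nlinarith

lemma degree_eq (m : Fin 4 →₀ ℕ) : Finsupp.weight (1 : Fin 4 → ℕ) m = m 0 + m 1 + m 2 + m 3 := by
  rw [Finsupp.weight_apply, Finsupp.sum_fintype _ _ (by simp)]
  simp [Fin.sum_univ_four]

lemma mem_Hk (k : ℕ) (p : Rpoly) : p ∈ Hk k ↔
    (∀ m, coeff m p ≠ 0 → m 0 + m 1 + m 2 + m 3 = k) ∧ p ∈ LinearMap.ker ΔOp := by
  rw [Hk, Submodule.mem_inf, mem_homogeneousSubmodule]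
  apply and_congr_left'
  simp only [IsHomogeneous, IsWeightedHomogeneous, degree_eq]

lemma mem_eig (μ : ℂ) (p : Rpoly) : p ∈ Module.End.eigenspace vertLap μ ↔
    ∀ m, coeff m p ≠ 0 → ((m 1 : ℂ) - m 0 + m 3 - m 2) ^ 2 / 2 = μ := by
  rw [Module.End.mem_eigenspace_iff]
  constructor
  · intro h m hm
    have := congrArg (coeff m) h
    rw [coeff_vertLap, coeff_smul, smul_eq_mul] at this
    exact mul_right_cancel₀ hm this
  · intro h
    ext m
    rw [coeff_vertLap, coeff_smul, smul_eq_mul]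
    by_cases hm : coeff m p = 0
    · simp [hm]
    · rw [h m hm]

lemma eig_cases (k l : ℕ) (hl : l ≤ k) (m : Fin 4 →₀ ℕ) (hm : m 0 + m 1 + m 2 + m 3 = k) :
    ((m 1 : ℂ) - m 0 + m 3 - m 2) ^ 2 / 2 = ((k : ℂ) - 2 * l) ^ 2 / 2 ↔
      m ∈ bideg l (k - l) ∪ bideg (k - l) l := by
  have h1 : ((m 1 : ℂ) - m 0 + m 3 - m 2) ^ 2 / 2 = ((k : ℂ) - 2 * l) ^ 2 / 2 ↔
      ((m 1 : ℤ) - m 0 + m 3 - m 2) ^ 2 = ((k : ℤ) - 2 * l) ^ 2 := by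
    rw [div_left_inj' (by norm_num)]
    exact_mod_cast Iff.rfl
  rw [h1, sq_eq_sq_iff_eq_or_eq_neg]
  simp only [bideg, Set.mem_union, Set.mem_setOf_eq]
  omega

/-- Projection to a bidegree. -/
noncomputable def proj (a b : ℕ) (p : Rpoly) : Rpoly := by
  classical exact ∑ m ∈ p.support with m ∈ bideg a b, monomial m (coeff m p)

lemma coeff_proj (a b : ℕ) (p : Rpoly) (m : Fin 4 →₀ ℕ) [Decidable (m ∈ bideg a b)] :
    coeff m (proj a b p) = if m ∈ bideg a b then coeff m p else 0 := by
  classical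
  rw [proj, coeff_sum]
  simp only [coeff_monomial, Finset.sum_ite_eq', Finset.mem_filter, mem_support_iff]
  by_cases h : m ∈ bideg a b <;> by_cases h' : coeff m p = 0 <;> simp [h, h']

lemma proj_mem (a b : ℕ) (p : Rpoly) (hp : p ∈ LinearMap.ker ΔOp) : proj a b p ∈ Hab a b := by
  classical
  refine ⟨mem_rs.2 fun m hm => by rw [coeff_proj, if_neg hm], ?_⟩
  rw [SetLike.mem_coe, harm_iff]
  intro i j u v
  have h := (harm_iff p).1 hp i j u v
  have hm : mkE i j (u + 1) (v + 1) ∈ bideg a b ↔ mkE (i + 1) (j + 1) u v ∈ bideg a b := by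
    simp only [bideg, Set.mem_setOf_eq, mkE_zero, mkE_one, mkE_two, mkE_three]
    omega
  rw [coeff_proj, coeff_proj]
  by_cases hc : mkE (i + 1) (j + 1) u v ∈ bideg a b
  · rw [if_pos hc, if_pos (hm.2 hc), h]
  · rw [if_neg hc, if_neg (fun h => hc (hm.1 h))]
    simp

lemma not_bideg_both {a b c d : ℕ} (h : a ≠ c) {m : Fin 4 →₀ ℕ} (h1 : m ∈ bideg a b)
    (h2 : m ∈ bideg c d) : False := h (h1.1.symm.trans h2.1)

lemma hk_inf_eig (k l : ℕ) (hl : l ≤ k) :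
    Hk k ⊓ Module.End.eigenspace vertLap (((k : ℂ) - 2 * l) ^ 2 / 2) =
      Hab l (k - l) ⊔ Hab (k - l) l := by
  classical
  apply le_antisymm
  · rintro p ⟨hp, he⟩
    rw [SetLike.mem_coe, mem_Hk] at hp
    rw [SetLike.mem_coe, mem_eig] at he
    have hsupp : ∀ m, coeff m p ≠ 0 → m ∈ bideg l (k - l) ∪ bideg (k - l) l := fun m hm =>
      (eig_cases k l hl m (hp.1 m hm)).1 (he m hm)
    by_cases hlk : l = k - l
    · apply Submodule.mem_sup_left
      refine ⟨mem_rs.2 fun m hm => ?_, hp.2⟩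
      by_contra hc
      have := hsupp m hc
      rw [← hlk, Set.union_self] at this
      rw [← hlk] at hm
      exact hm this
    · rw [Submodule.mem_sup]
      refine ⟨_, proj_mem l (k - l) p hp.2, _, proj_mem (k - l) l p hp.2, ?_⟩
      ext m
      rw [coeff_add, coeff_proj, coeff_proj]
      by_cases h1 : m ∈ bideg l (k - l)
      · rw [if_pos h1, if_neg (fun h2 => not_bideg_both hlk h1 h2), add_zero]
      · rw [if_neg h1, zero_add]
        split_ifs with h2
        · rfl
        · by_contra hc
          rcases hsupp m (Ne.symm hc) with h | h
          · exact h1 h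
          · exact h2 h
  · have aux : ∀ a b, bideg a b ⊆ bideg l (k - l) ∪ bideg (k - l) l → a + b = k →
        Hab a b ≤ Hk k ⊓ Module.End.eigenspace vertLap (((k : ℂ) - 2 * l) ^ 2 / 2) := by
      rintro a b hab hk p ⟨h1, h2⟩
      have h3 : ∀ m, coeff m p ≠ 0 → m ∈ bideg a b := fun m hm => by
        by_contra hc
        exact hm (mem_rs.1 h1 m hc)
      have h4 : ∀ m, coeff m p ≠ 0 → m 0 + m 1 + m 2 + m 3 = k := fun m hm => by
        have := (h3 m hm).1
        have := (h3 m hm).2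
        omega
      refine ⟨(mem_Hk k p).2 ⟨h4, h2⟩, (mem_eig _ p).2 fun m hm => ?_⟩
      exact (eig_cases k l hl m (h4 m hm)).2 (hab (h3 m hm))
    exact sup_le (aux _ _ Set.subset_union_left (by omega))
      (aux _ _ Set.subset_union_right (by omega))

/-- the spectrum of `Δ^V = (1/2)h²` restricted to the
`λ_k = k(k+2)/2`-eigenspace of the Laplacian of `S³(√2)` (i.e. to `H^k`) consists
of the values `(k−2l)²/2`, `l ∈ {0,…,k}`; each nonzero value has multiplicity
`2(k+1)` and, for `k` even, the value `0` has multiplicity `k+1`. -/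
theorem spectrum_vertical_laplacian (k : ℕ) :
    (∀ l : ℕ, l ≤ k → (k : ℤ) - 2 * l ≠ 0 →
      Module.finrank ℂ
        ↥(Hk k ⊓ Module.End.eigenspace vertLap (((k : ℂ) - 2 * l) ^ 2 / 2)) =
        2 * (k + 1)) ∧
    (Even k →
      Module.finrank ℂ ↥(Hk k ⊓ Module.End.eigenspace vertLap 0) = k + 1) ∧
    (∀ (μ : ℂ) (p : Rpoly), p ∈ Hk k → p ≠ 0 → vertLap p = μ • p →
      ∃ l : ℕ, l ≤ k ∧ μ = ((k : ℂ) - 2 * l) ^ 2 / 2) := by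
  refine ⟨?_, ?_, ?_⟩
  · intro l hl hne
    rw [hk_inf_eig k l hl]
    have h := Submodule.finrank_sup_add_finrank_inf_eq (Hab l (k - l)) (Hab (k - l) l)
    have hbot : Hab l (k - l) ⊓ Hab (k - l) l = ⊥ := by
      rw [eq_bot_iff]
      rintro p ⟨h1, h2⟩
      rw [Submodule.mem_bot]
      ext m
      rw [coeff_zero]
      by_contra hc
      have a1 : m ∈ bideg l (k - l) := by
        by_contra hn
        exact hc (mem_rs.1 h1.1 m hn)
      have a2 : m ∈ bideg (k - l) l := by
        by_contra hn
        exact hc (mem_rs.1 h2.1 m hn)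
      exact not_bideg_both (by omega) a1 a2
    rw [hbot, finrank_bot, finrank_Hab, finrank_Hab] at h
    omega
  · rintro ⟨l, rfl⟩
    have h := hk_inf_eig (l + l) l (by omega)
    have e : (((l + l : ℕ) : ℂ) - 2 * l) ^ 2 / 2 = 0 := by
      push_cast
      ring
    rw [e, Nat.add_sub_cancel, sup_idem] at h
    rw [h, finrank_Hab]
  · intro μ p hp h0 he
    obtain ⟨m, hm⟩ := MvPolynomial.ne_zero_iff.1 h0
    have h1 := ((mem_Hk k p).1 hp).1 m hm
    have h2 := (mem_eig μ p).1 (Module.End.mem_eigenspace_iff.2 he) m hm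
    refine ⟨m 0 + m 2, by omega, ?_⟩
    rw [← h2, ← h1]
    push_cast
    ring
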